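/- Let (X_i)_{i≥1} be a strictly stationary sequence of centered real random variables bounded by M, with strong mixing coefficients α(k). Then E[max_{1≤k≤n} (Σ_{i=1}^k X_i)²] ≤ 16 M² n Σ_{k≥0} α(k). -/

import Mathlib

open MeasureTheory

noncomputable def alphaSig {Ω : Type*} [MeasurableSpace Ω] (ℙ : Measure Ω)
    (m₁ m₂ : MeasurableSpace Ω) : ℝ :=
  sSup {r : ℝ | ∃ A B : Set Ω, MeasurableSet[m₁] A ∧ MeasurableSet[m₂] B ∧
      r = |(ℙ (A ∩ B)).toReal - (ℙ A).toReal * (ℙ B).toReal|}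

/-- The strong mixing coefficients `α(k)` of the sequence `X`. -/
noncomputable def mixCoef {Ω : Type*} [MeasurableSpace Ω] (ℙ : Measure Ω) (X : ℕ → Ω → ℝ) (k : ℕ) : ℝ :=
  ⨆ l : ℕ, alphaSig ℙ
    (⨆ i ∈ Set.Icc 1 l, MeasurableSpace.comap (X i) (borel ℝ))
    (⨆ i ∈ Set.Ici (l + k), MeasurableSpace.comap (X i) (borel ℝ))


/-- Running maximum (with zero) of the partial sums of `y`. -/
noncomputable def runMax (y : ℕ → ℝ) : ℕ → ℝ
  | 0 => 0
  | k + 1 => max (runMax y k) (∑ i ∈ Finset.range (k + 1), y i)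

/-- Running minimum (with zero) of the partial sums of `y`. -/
noncomputable def runMin (y : ℕ → ℝ) : ℕ → ℝ
  | 0 => 0
  | k + 1 => min (runMin y k) (∑ i ∈ Finset.range (k + 1), y i)

lemma le_runMax (y : ℕ → ℝ) (k : ℕ) : ∀ j ≤ k, ∑ i ∈ Finset.range j, y i ≤ runMax y k := by
  induction k with
  | zero => intro j hj; obtain rfl : j = 0 := by omega
            simp [runMax]
  | succ k ih =>
    intro j hj
    rcases Nat.lt_or_ge k j with h | h
    · obtain rfl : j = k + 1 := by omega
      exact le_max_right _ _
    · exact (ih j h).trans (le_max_left _ _)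

lemma runMin_le (y : ℕ → ℝ) (k : ℕ) : ∀ j ≤ k, runMin y k ≤ ∑ i ∈ Finset.range j, y i := by
  induction k with
  | zero => intro j hj; obtain rfl : j = 0 := by omega
            simp [runMin]
  | succ k ih =>
    intro j hj
    rcases Nat.lt_or_ge k j with h | h
    · obtain rfl : j = k + 1 := by omega
      exact min_le_right _ _
    · exact (min_le_left _ _).trans (ih j h)

/-- The process `2 S - max - min`. -/
noncomputable def zProc (y : ℕ → ℝ) (k : ℕ) : ℝ :=
  2 * (∑ i ∈ Finset.range k, y i) - runMax y k - runMin y k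

lemma runMax_sq (y : ℕ → ℝ) (k : ℕ) :
    (runMax y k - ∑ i ∈ Finset.range k, y i) ^ 2
      ≤ (∑ i ∈ Finset.range k, y i) ^ 2 - 2 * ∑ i ∈ Finset.range k, runMax y i * y i := by
  induction k with
  | zero => simp [runMax]
  | succ k ih =>
    have h1 : runMax y (k + 1) = max (runMax y k) (∑ i ∈ Finset.range (k + 1), y i) := rfl
    rw [h1]
    simp only [Finset.sum_range_succ]
    rcases le_total (runMax y k) (∑ i ∈ Finset.range k, y i + y k) with h | h
    · rw [max_eq_right h]
      nlinarith [sq_nonneg (runMax y k - ∑ i ∈ Finset.range k, y i - y k)]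
    · rw [max_eq_left h]
      nlinarith

lemma runMin_sq (y : ℕ → ℝ) (k : ℕ) :
    (runMin y k - ∑ i ∈ Finset.range k, y i) ^ 2
      ≤ (∑ i ∈ Finset.range k, y i) ^ 2 - 2 * ∑ i ∈ Finset.range k, runMin y i * y i := by
  induction k with
  | zero => simp [runMin]
  | succ k ih =>
    have h1 : runMin y (k + 1) = min (runMin y k) (∑ i ∈ Finset.range (k + 1), y i) := rfl
    rw [h1]
    simp only [Finset.sum_range_succ]
    rcases le_total (runMin y k) (∑ i ∈ Finset.range k, y i + y k) with h | h
    · rw [min_eq_left h]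
      nlinarith
    · rw [min_eq_right h]
      nlinarith [sq_nonneg (runMin y k - ∑ i ∈ Finset.range k, y i - y k)]

lemma sum_sq_eq (y : ℕ → ℝ) (k : ℕ) :
    (∑ i ∈ Finset.range k, y i) ^ 2 = ∑ i ∈ Finset.range k, y i ^ 2
      + 2 * ∑ i ∈ Finset.range k, (∑ j ∈ Finset.range i, y j) * y i := by
  induction k with
  | zero => simp
  | succ k ih => simp only [Finset.sum_range_succ]; nlinarith

lemma zProc_step (y : ℕ → ℝ) (k : ℕ) : |zProc y (k + 1) - zProc y k| ≤ 2 * |y k| := by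
  have h1 : runMax y (k + 1) = max (runMax y k) (∑ i ∈ Finset.range (k + 1), y i) := rfl
  have h2 : runMin y (k + 1) = min (runMin y k) (∑ i ∈ Finset.range (k + 1), y i) := rfl
  have h3 := le_runMax y k k le_rfl
  have h4 := runMin_le y k k le_rfl
  unfold zProc
  rw [h1, h2]
  simp only [Finset.sum_range_succ]
  rcases le_total (runMax y k) (∑ i ∈ Finset.range k, y i + y k) with h | h <;>
  rcases le_total (runMin y k) (∑ i ∈ Finset.range k, y i + y k) with h' | h' <;>
  rcases abs_cases (y k) with ⟨h5, h6⟩ | ⟨h5, h6⟩ <;>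
  simp only [h, h', max_eq_left, max_eq_right, min_eq_left, min_eq_right, h5] <;>
  rw [abs_le] <;> constructor <;> linarith

lemma pathwise (y : ℕ → ℝ) (n j : ℕ) (hj : j ≤ n) :
    (∑ i ∈ Finset.range n, y i - ∑ i ∈ Finset.range j, y i) ^ 2
      ≤ 2 * ∑ i ∈ Finset.range n, y i ^ 2
        + 2 * ∑ i ∈ Finset.range n, ∑ k ∈ Finset.range i, (zProc y (k + 1) - zProc y k) * y i := by
  have h1 := runMax_sq y n
  have h2 := runMin_sq y n
  have h3 := sum_sq_eq y n
  have h4 := le_runMax y n j hj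
  have h5 := runMin_le y n j hj
  have h6 : ∑ i ∈ Finset.range n, ∑ k ∈ Finset.range i, (zProc y (k + 1) - zProc y k) * y i
      = 2 * ∑ i ∈ Finset.range n, (∑ j ∈ Finset.range i, y j) * y i
        - ∑ i ∈ Finset.range n, runMax y i * y i - ∑ i ∈ Finset.range n, runMin y i * y i := by
    rw [Finset.mul_sum, ← Finset.sum_sub_distrib, ← Finset.sum_sub_distrib]
    refine Finset.sum_congr rfl fun i _ => ?_
    rw [← Finset.sum_mul, Finset.sum_range_sub]
    simp only [zProc, runMax, runMin, Finset.range_zero, Finset.sum_empty]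
    ring
  rw [h6]
  have h7 := le_runMax y n n le_rfl
  have h8 := runMin_le y n n le_rfl
  have key : (∑ i ∈ Finset.range n, y i - ∑ i ∈ Finset.range j, y i) ^ 2
      ≤ (runMax y n - ∑ i ∈ Finset.range n, y i) ^ 2
        + (runMin y n - ∑ i ∈ Finset.range n, y i) ^ 2 := by
    rcases le_total (∑ i ∈ Finset.range j, y i) (∑ i ∈ Finset.range n, y i) with h | h
    · nlinarith [sq_nonneg (runMax y n - ∑ i ∈ Finset.range n, y i)]
    · nlinarith [sq_nonneg (runMin y n - ∑ i ∈ Finset.range n, y i)]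
  linarith

section cov

variable {Ω : Type*} [m0 : MeasurableSpace Ω] (μ : Measure Ω) [IsProbabilityMeasure μ]

/-- sign variable of a set -/
noncomputable def sgnSet (A : Set Ω) (ω : Ω) : ℝ := 2 * A.indicator (fun _ => (1 : ℝ)) ω - 1

lemma sgnSet_abs (A : Set Ω) (ω : Ω) : |sgnSet A ω| ≤ 1 := by
  unfold sgnSet
  by_cases h : ω ∈ A <;> norm_num [h]

lemma sgnSet_meas (m : MeasurableSpace Ω) (A : Set Ω) (hA : MeasurableSet[m] A) :
    Measurable[m] (sgnSet A) := by
  have : Measurable[m] (A.indicator (fun _ => (1 : ℝ))) := measurable_const.indicator hA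
  exact (this.const_mul 2).sub_const 1

lemma int_bdd {f : Ω → ℝ} (hf : Measurable f) {a : ℝ} (h : ∀ ω, |f ω| ≤ a) :
    Integrable f μ :=
  Integrable.of_bound hf.aestronglyMeasurable a (Filter.Eventually.of_forall fun ω => by
    simpa using h ω)

lemma int_bdd_mul {f g : Ω → ℝ} (hf : Measurable f) (hg : Measurable g) {a b : ℝ}
    (h : ∀ ω, |f ω| ≤ a) (h' : ∀ ω, |g ω| ≤ b) :
    Integrable (fun ω => f ω * g ω) μ :=
  int_bdd μ (a := a * b) (hf.mul hg) fun ω => by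
    rw [abs_mul]
    exact mul_le_mul (h ω) (h' ω) (abs_nonneg _) ((abs_nonneg _).trans (h ω))

lemma cov_step {Ω : Type*} (m : MeasurableSpace Ω) [m0 : MeasurableSpace Ω] (μ : Measure Ω)
    [IsProbabilityMeasure μ] (hm : m ≤ m0) {f g : Ω → ℝ} (hf : Measurable[m] f)
    (hg : Measurable g) {a b : ℝ} (hfa : ∀ ω, |f ω| ≤ a) (hgb : ∀ ω, |g ω| ≤ b) :
    ∃ A, MeasurableSet[m] A ∧ ∫ ω, f ω * g ω ∂μ - (∫ ω, f ω ∂μ) * (∫ ω, g ω ∂μ)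
      ≤ a * (∫ ω, sgnSet A ω * g ω ∂μ - (∫ ω, sgnSet A ω ∂μ) * (∫ ω, g ω ∂μ)) := by
  set h : Ω → ℝ := fun ω => (μ[g|m]) ω - ∫ ω, g ω ∂μ with hh
  have hgi : Integrable g μ := int_bdd μ hg hgb
  have hhm : Measurable[m] h := stronglyMeasurable_condExp.measurable.sub_const _
  have hhi : Integrable h μ := integrable_condExp.sub (integrable_const _)
  have key : ∀ (u : Ω → ℝ) (c : ℝ), Measurable[m] u → (∀ ω, |u ω| ≤ c) →
      Integrable (fun ω => u ω * h ω) μ ∧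
      ∫ ω, u ω * g ω ∂μ - (∫ ω, u ω ∂μ) * (∫ ω, g ω ∂μ) = ∫ ω, u ω * h ω ∂μ := by
    intro u c hu huc
    have hu0 : Measurable u := hu.mono hm le_rfl
    have hui := int_bdd μ hu0 huc
    have i1 : Integrable (fun ω => u ω * g ω) μ := int_bdd_mul μ hu0 hg huc hgb
    have i2 : Integrable (fun ω => u ω * (μ[g|m]) ω) μ :=
      integrable_condExp.bdd_mul (c := c) hu0.aestronglyMeasurable
        (Filter.Eventually.of_forall fun ω => by simpa using huc ω)
    have e1 : ∫ ω, u ω * g ω ∂μ = ∫ ω, u ω * (μ[g|m]) ω ∂μ := by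
      rw [← integral_condExp hm (f := fun ω => u ω * g ω)]
      exact integral_congr_ae
        (condExp_mul_of_stronglyMeasurable_left (f := u) (g := g) hu.stronglyMeasurable i1 hgi)
    constructor
    · have := i2.sub (hui.mul_const (∫ ω, g ω ∂μ))
      refine this.congr (Filter.Eventually.of_forall fun ω => ?_)
      simp [hh, mul_sub]
    · simp only [hh, mul_sub]
      rw [integral_sub i2 (hui.mul_const _), integral_mul_const, e1]
  have hA : MeasurableSet[m] {ω | 0 ≤ h ω} := measurableSet_le measurable_const hhm
  refine ⟨{ω | 0 ≤ h ω}, hA, ?_⟩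
  obtain ⟨k1, k2⟩ := key f a hf hfa
  obtain ⟨k3, k4⟩ := key _ 1 (sgnSet_meas m _ hA) (sgnSet_abs _)
  rw [k2, k4, ← integral_const_mul]
  refine integral_mono k1 (k3.const_mul a) fun ω => ?_
  have := abs_le.1 (hfa ω)
  by_cases hω : 0 ≤ h ω
  · have : sgnSet {ω | 0 ≤ h ω} ω = 1 := by
      simp [sgnSet, Set.indicator, hω]; norm_num
    simp only [this]; nlinarith
  · have : sgnSet {ω | 0 ≤ h ω} ω = -1 := by
      simp [sgnSet, Set.indicator, hω]
    simp only [this]; nlinarith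

lemma alphaSig_mem_le (A B : Set Ω) :
    |(μ (A ∩ B)).toReal - (μ A).toReal * (μ B).toReal| ≤ 1 := by
  have h1 : (μ (A ∩ B)).toReal ≤ 1 := measureReal_le_one
  have h2 : (μ A).toReal ≤ 1 := measureReal_le_one
  have h3 : (μ B).toReal ≤ 1 := measureReal_le_one
  have h4 : 0 ≤ (μ (A ∩ B)).toReal := ENNReal.toReal_nonneg
  have h5 : 0 ≤ (μ A).toReal := ENNReal.toReal_nonneg
  have h6 : 0 ≤ (μ B).toReal := ENNReal.toReal_nonneg
  rw [abs_le]; constructor <;> nlinarith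

lemma alphaSig_le_one {Ω : Type*} (m₁ m₂ : MeasurableSpace Ω) [m0 : MeasurableSpace Ω]
    (μ : Measure Ω) [IsProbabilityMeasure μ] : alphaSig μ m₁ m₂ ≤ 1 := by
  refine csSup_le ⟨_, ∅, ∅, @MeasurableSet.empty _ m₁, @MeasurableSet.empty _ m₂, rfl⟩ ?_
  rintro r ⟨A, B, -, -, rfl⟩
  exact alphaSig_mem_le μ A B

lemma le_alphaSig {Ω : Type*} (m₁ m₂ : MeasurableSpace Ω) [m0 : MeasurableSpace Ω]
    (μ : Measure Ω) [IsProbabilityMeasure μ] (A B : Set Ω) (hA : MeasurableSet[m₁] A)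
    (hB : MeasurableSet[m₂] B) :
    |(μ (A ∩ B)).toReal - (μ A).toReal * (μ B).toReal| ≤ alphaSig μ m₁ m₂ := by
  refine le_csSup ⟨1, ?_⟩ ⟨A, B, hA, hB, rfl⟩
  rintro r ⟨A, B, -, -, rfl⟩
  exact alphaSig_mem_le μ A B

lemma cov_sgn (A B : Set Ω) (hA : MeasurableSet A) (hB : MeasurableSet B) :
    ∫ ω, sgnSet A ω * sgnSet B ω ∂μ - (∫ ω, sgnSet A ω ∂μ) * (∫ ω, sgnSet B ω ∂μ)
      = 4 * ((μ (A ∩ B)).toReal - (μ A).toReal * (μ B).toReal) := by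
  have hi : ∀ C : Set Ω, MeasurableSet C → Integrable (C.indicator (fun _ => (1 : ℝ))) μ :=
    fun C hC => (integrable_const _).indicator hC
  have hv : ∀ C : Set Ω, MeasurableSet C →
      ∫ ω, C.indicator (fun _ => (1 : ℝ)) ω ∂μ = (μ C).toReal := by
    intro C hC
    rw [integral_indicator hC]; simp [Measure.real]
  have e : ∀ C : Set Ω, MeasurableSet C → ∫ ω, sgnSet C ω ∂μ = 2 * (μ C).toReal - 1 := by
    intro C hC
    unfold sgnSet
    rw [integral_sub ((hi C hC).const_mul 2) (integrable_const _), integral_const_mul, hv C hC]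
    simp
  have e2 : ∀ ω, sgnSet A ω * sgnSet B ω = 4 * (A ∩ B).indicator (fun _ => (1 : ℝ)) ω
      - (sgnSet A ω + sgnSet B ω + 1) := by
    intro ω
    unfold sgnSet
    by_cases h1 : ω ∈ A <;> by_cases h2 : ω ∈ B <;> simp [h1, h2] <;> norm_num
  have sA : Integrable (sgnSet A) μ := ((hi A hA).const_mul 2).sub (integrable_const _)
  have sB : Integrable (sgnSet B) μ := ((hi B hB).const_mul 2).sub (integrable_const _)
  have e3 : ∫ ω, sgnSet A ω * sgnSet B ω ∂μ
      = 4 * (μ (A ∩ B)).toReal - ((2 * (μ A).toReal - 1) + (2 * (μ B).toReal - 1) + 1) := by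
    simp only [e2]
    have sAB : Integrable (fun ω => sgnSet A ω + sgnSet B ω) μ := sA.add sB
    have sAB1 : Integrable (fun ω => sgnSet A ω + sgnSet B ω + 1) μ :=
      sAB.add (integrable_const _)
    rw [integral_sub ((hi _ (hA.inter hB)).const_mul 4) sAB1,
      integral_const_mul, hv _ (hA.inter hB), integral_add sAB (integrable_const _),
      integral_add sA sB, e A hA, e B hB]
    simp
  rw [e3, e A hA, e B hB]; ring

lemma cov_le {Ω : Type*} (m₁ m₂ : MeasurableSpace Ω) [m0 : MeasurableSpace Ω]
    (μ : Measure Ω) [IsProbabilityMeasure μ] (h1 : m₁ ≤ m0) (h2 : m₂ ≤ m0) {f g : Ω → ℝ}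
    (hf : Measurable[m₁] f) (hg : Measurable[m₂] g) {a b : ℝ} (ha : 0 ≤ a) (hb : 0 ≤ b)
    (hfa : ∀ ω, |f ω| ≤ a) (hgb : ∀ ω, |g ω| ≤ b) :
    ∫ ω, f ω * g ω ∂μ - (∫ ω, f ω ∂μ) * (∫ ω, g ω ∂μ) ≤ 4 * a * b * alphaSig μ m₁ m₂ := by
  obtain ⟨A, hA, hA'⟩ := cov_step m₁ μ h1 hf (hg.mono h2 le_rfl) hfa hgb
  obtain ⟨B, hB, hB'⟩ := cov_step m₂ μ h2 hg ((sgnSet_meas m₁ A hA).mono h1 le_rfl) hgb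
    (sgnSet_abs A)
  have h3 := cov_sgn μ B A (h2 _ hB) (h1 _ hA)
  rw [h3] at hB'
  have h4 := (le_abs_self _).trans (le_alphaSig m₁ m₂ μ A B hA hB)
  rw [Set.inter_comm B A] at hB'
  simp only [mul_comm (g _), mul_comm (∫ ω, g ω ∂μ)] at hB'
  calc _ ≤ _ := hA'
    _ ≤ a * (b * (4 * alphaSig μ m₁ m₂)) := by
      refine mul_le_mul_of_nonneg_left (hB'.trans (mul_le_mul_of_nonneg_left ?_ hb)) ha
      linarith
    _ = _ := by ring

lemma alphaSig_le_mixCoef (X : ℕ → Ω → ℝ) (l k : ℕ) :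
    alphaSig μ (⨆ i ∈ Set.Icc 1 l, MeasurableSpace.comap (X i) (borel ℝ))
      (⨆ i ∈ Set.Ici (l + k), MeasurableSpace.comap (X i) (borel ℝ)) ≤ mixCoef μ X k := by
  unfold mixCoef
  refine le_ciSup (f := fun l : ℕ => alphaSig μ
    (⨆ i ∈ Set.Icc 1 l, MeasurableSpace.comap (X i) (borel ℝ))
    (⨆ i ∈ Set.Ici (l + k), MeasurableSpace.comap (X i) (borel ℝ))) ⟨1, ?_⟩ l
  rintro _ ⟨l, rfl⟩
  exact alphaSig_le_one _ _ μ

lemma alphaSig_nonneg {Ω : Type*} (m₁ m₂ : MeasurableSpace Ω) [m0 : MeasurableSpace Ω]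
    (μ : Measure Ω) [IsProbabilityMeasure μ] : 0 ≤ alphaSig μ m₁ m₂ :=
  (abs_nonneg _).trans (le_alphaSig m₁ m₂ μ ∅ ∅ (@MeasurableSet.empty _ m₁)
    (@MeasurableSet.empty _ m₂))

lemma mixCoef_nonneg (X : ℕ → Ω → ℝ) (k : ℕ) : 0 ≤ mixCoef μ X k :=
  (alphaSig_nonneg _ _ μ).trans (alphaSig_le_mixCoef μ X 0 k)

end cov

lemma meas_partial {Ω : Type*} (m : MeasurableSpace Ω) (Y : ℕ → Ω → ℝ) (k : ℕ)
    (h : ∀ i < k, Measurable[m] (Y i)) : ∀ j ≤ k,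
    Measurable[m] (fun ω => ∑ i ∈ Finset.range j, Y i ω) := by
  intro j hj
  exact Finset.measurable_fun_sum _ fun i hi => h i (by simp at hi; omega)

lemma meas_zProc {Ω : Type*} (m : MeasurableSpace Ω) (Y : ℕ → Ω → ℝ) (k : ℕ)
    (h : ∀ i < k, Measurable[m] (Y i)) :
    Measurable[m] (fun ω => zProc (fun i => Y i ω) k) := by
  have hmax : ∀ j ≤ k, Measurable[m] (fun ω => runMax (fun i => Y i ω) j) := by
    intro j
    induction j with
    | zero => intro _; simp only [runMax]; exact measurable_const
    | succ j ih => intro hj; exact (ih (by omega)).max (meas_partial m Y k h _ hj)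
  have hmin : ∀ j ≤ k, Measurable[m] (fun ω => runMin (fun i => Y i ω) j) := by
    intro j
    induction j with
    | zero => intro _; simp only [runMin]; exact measurable_const
    | succ j ih => intro hj; exact (ih (by omega)).min (meas_partial m Y k h _ hj)
  exact (((meas_partial m Y k h k le_rfl).const_mul 2).sub (hmax k le_rfl)).sub (hmin k le_rfl)

lemma meas_sup {Ω : Type*} (X : ℕ → Ω → ℝ) (s : Set ℕ) (i : ℕ) (hi : i ∈ s) :
    Measurable[⨆ i ∈ s, MeasurableSpace.comap (X i) (borel ℝ)] (X i) := by
  rw [measurable_iff_comap_le]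
  have : (inferInstance : MeasurableSpace ℝ) = borel ℝ := BorelSpace.measurable_eq
  rw [← this]
  exact le_iSup₂ (f := fun i (_ : i ∈ s) =>
    MeasurableSpace.comap (X i) (inferInstance : MeasurableSpace ℝ)) i hi

lemma sup_le_m0 {Ω : Type*} [m0 : MeasurableSpace Ω] (X : ℕ → Ω → ℝ)
    (hX : ∀ i, Measurable (X i)) (s : Set ℕ) :
    (⨆ i ∈ s, MeasurableSpace.comap (X i) (borel ℝ)) ≤ m0 := by
  have : (inferInstance : MeasurableSpace ℝ) = borel ℝ := BorelSpace.measurable_eq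
  rw [← this]
  exact iSup₂_le fun i _ => (hX i).comap_le

theorem stmt_17 {Ω : Type*} [MeasurableSpace Ω] (ℙ : Measure Ω) [IsProbabilityMeasure ℙ]
    (X : ℕ → Ω → ℝ) (hXm : ∀ i, Measurable (X i))
    (M : ℝ) (hM : ∀ i ω, |X i ω| ≤ M)
    (hcent : ∀ i, ∫ ω, X i ω ∂ℙ = 0)
    (hstat : ∀ (k m : ℕ),
      Measure.map (fun ω (i : Fin m) => X ((i : ℕ) + 1) ω) ℙ
        = Measure.map (fun ω (i : Fin m) => X ((i : ℕ) + 1 + k) ω) ℙ)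
    (hsum : Summable (mixCoef ℙ X))
    (n : ℕ) (hn : 1 ≤ n) :
    ∫ ω, (Finset.Icc 1 n).sup' (Finset.nonempty_Icc.mpr hn)
        (fun k => (∑ i ∈ Finset.Icc 1 k, X i ω) ^ 2) ∂ℙ
      ≤ 16 * M ^ 2 * n * ∑' k, mixCoef ℙ X k := by
  obtain ⟨ω₀⟩ : Nonempty Ω := nonempty_of_isProbabilityMeasure ℙ
  have hM0 : 0 ≤ M := (abs_nonneg _).trans (hM 0 ω₀)
  set Y : ℕ → Ω → ℝ := fun i => X (n - i) with hY
  set e : ℕ → Ω → ℝ := fun k ω =>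
    zProc (fun i => Y i ω) (k + 1) - zProc (fun i => Y i ω) k with he
  set α := mixCoef ℙ X with hα
  have hα0 : ∀ k, 0 ≤ α k := mixCoef_nonneg ℙ X
  have hYm : ∀ i, Measurable (Y i) := fun i => hXm _
  have hem : ∀ k, Measurable (e k) := fun k =>
    (meas_zProc _ Y (k + 1) fun i _ => hYm i).sub (meas_zProc _ Y k fun i _ => hYm i)
  have heb : ∀ k ω, |e k ω| ≤ 2 * M := fun k ω =>
    (zProc_step (fun i => Y i ω) k).trans (by have := hM (n - k) ω; simp only [hY]; linarith)
  -- covariance bounds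
  have c0 : ∀ i < n, ∫ ω, Y i ω ^ 2 ∂ℙ ≤ 4 * M ^ 2 * α 0 := by
    intro i hi
    have h := cov_le _ _ ℙ (sup_le_m0 X hXm (Set.Icc 1 (n - i)))
      (sup_le_m0 X hXm (Set.Ici (n - i + 0)))
      (meas_sup X _ (n - i) (by simp; omega)) (meas_sup X _ (n - i) (by simp)) hM0 hM0
      (hM _) (hM _)
    rw [hcent] at h
    have h' := alphaSig_le_mixCoef ℙ X (n - i) 0
    have e1 : ∫ ω, Y i ω ^ 2 ∂ℙ = ∫ ω, X (n - i) ω * X (n - i) ω ∂ℙ := by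
      simp only [hY, pow_two]
    rw [e1]
    have := mul_le_mul_of_nonneg_left h' (by positivity : 0 ≤ 4 * M * M)
    nlinarith
  have c1 : ∀ i < n, ∀ k < i, ∫ ω, e k ω * Y i ω ∂ℙ ≤ 8 * M ^ 2 * α (i - k) := by
    intro i hi k hk
    have hmeas : Measurable[⨆ j ∈ Set.Ici (n - i + (i - k)),
        MeasurableSpace.comap (X j) (borel ℝ)] (e k) := by
      refine (meas_zProc _ Y (k + 1) fun j hj => ?_).sub (meas_zProc _ Y k fun j hj => ?_)
      · exact meas_sup X _ (n - j) (by simp; omega)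
      · exact meas_sup X _ (n - j) (by simp; omega)
    have h := cov_le _ _ ℙ (sup_le_m0 X hXm (Set.Icc 1 (n - i)))
      (sup_le_m0 X hXm (Set.Ici (n - i + (i - k))))
      (meas_sup X _ (n - i) (by simp; omega)) hmeas hM0 (by positivity : 0 ≤ 2 * M)
      (hM _) (heb k)
    rw [hcent] at h
    have h' := alphaSig_le_mixCoef ℙ X (n - i) (i - k)
    have e1 : ∫ ω, e k ω * Y i ω ∂ℙ = ∫ ω, X (n - i) ω * e k ω ∂ℙ := by
      simp only [hY, mul_comm]
    rw [e1]
    have := mul_le_mul_of_nonneg_left h' (by positivity : 0 ≤ 4 * M * (2 * M))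
    nlinarith
  -- integrability
  have i0 : ∀ i, Integrable (fun ω => Y i ω ^ 2) ℙ := fun i => by
    simp only [pow_two]
    exact int_bdd_mul ℙ (hYm i) (hYm i) (hM _) (hM _)
  have i1 : ∀ i k, Integrable (fun ω => e k ω * Y i ω) ℙ := fun i k =>
    int_bdd_mul ℙ (hem k) (hYm i) (heb k) (hM _)
  have i2 : Integrable (fun ω => ∑ i ∈ Finset.range n, Y i ω ^ 2) ℙ :=
    integrable_finsetSum _ fun i _ => i0 i
  have i3 : ∀ i, Integrable (fun ω => ∑ k ∈ Finset.range i, e k ω * Y i ω) ℙ := fun i =>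
    integrable_finsetSum _ fun k _ => i1 i k
  have i4 : Integrable (fun ω => ∑ i ∈ Finset.range n, ∑ k ∈ Finset.range i, e k ω * Y i ω) ℙ :=
    integrable_finsetSum _ fun i _ => i3 i
  have hpath : ∀ ω, (Finset.Icc 1 n).sup' (Finset.nonempty_Icc.mpr hn)
        (fun k => (∑ i ∈ Finset.Icc 1 k, X i ω) ^ 2)
      ≤ 2 * ∑ i ∈ Finset.range n, Y i ω ^ 2
        + 2 * ∑ i ∈ Finset.range n, ∑ k ∈ Finset.range i, e k ω * Y i ω := by
    intro ω
    refine Finset.sup'_le _ _ fun m hm => ?_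
    rw [Finset.mem_Icc] at hm
    have h := pathwise (fun i => Y i ω) n (n - m) (by omega)
    have h2 : ∀ m ≤ n, ∑ i ∈ Finset.range n, Y i ω - ∑ i ∈ Finset.range (n - m), Y i ω
        = ∑ i ∈ Finset.Icc 1 m, X i ω := by
      intro m
      induction m with
      | zero => intro _; simp
      | succ m ih =>
        intro hm
        have h3 := ih (by omega)
        rw [Finset.sum_Icc_succ_top (by omega), ← h3]
        have h4 : n - m = n - (m + 1) + 1 := by omega
        rw [h4, Finset.sum_range_succ]
        have h5 : Y (n - (m + 1)) ω = X (m + 1) ω := by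
          simp only [hY]; congr 1; omega
        rw [h5]; ring
    rw [h2 m hm.2] at h
    exact h
  have hint : ∫ ω, (Finset.Icc 1 n).sup' (Finset.nonempty_Icc.mpr hn)
        (fun k => (∑ i ∈ Finset.Icc 1 k, X i ω) ^ 2) ∂ℙ
      ≤ ∫ ω, (2 * ∑ i ∈ Finset.range n, Y i ω ^ 2
        + 2 * ∑ i ∈ Finset.range n, ∑ k ∈ Finset.range i, e k ω * Y i ω) ∂ℙ := by
    refine integral_mono_of_nonneg (Filter.Eventually.of_forall fun ω => ?_)
      ((i2.const_mul 2).add (i4.const_mul 2)) (Filter.Eventually.of_forall hpath)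
    exact (sq_nonneg _).trans (Finset.le_sup' (fun k => (∑ i ∈ Finset.Icc 1 k, X i ω) ^ 2)
      (Finset.mem_Icc.2 ⟨le_rfl, hn⟩))
  refine hint.trans ?_
  rw [integral_add (i2.const_mul 2) (i4.const_mul 2), integral_const_mul, integral_const_mul,
    integral_finsetSum _ (fun i _ => i0 i), integral_finsetSum _ (fun i _ => i3 i)]
  have b0 : ∑ i ∈ Finset.range n, ∫ ω, Y i ω ^ 2 ∂ℙ ≤ n * (4 * M ^ 2 * α 0) := by
    have := Finset.sum_le_card_nsmul (Finset.range n) (fun i => ∫ ω, Y i ω ^ 2 ∂ℙ) _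
      fun i hi => c0 i (Finset.mem_range.1 hi)
    simpa using this
  have hs : ∀ i, ∑ k ∈ Finset.range i, α (i - k) ≤ ∑' k, α (k + 1) := by
    intro i
    have h1 : ∑ k ∈ Finset.range i, α (i - k) = ∑ k ∈ Finset.range i, α (k + 1) := by
      rw [← Finset.sum_range_reflect (fun k => α (k + 1))]
      refine Finset.sum_congr rfl fun k hk => ?_
      rw [Finset.mem_range] at hk
      congr 1; omega
    rw [h1]
    exact ((summable_nat_add_iff 1).2 hsum).sum_le_tsum _ fun k _ => hα0 _
  have b1 : ∑ i ∈ Finset.range n, ∫ ω, ∑ k ∈ Finset.range i, e k ω * Y i ω ∂ℙ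
      ≤ n * (8 * M ^ 2 * ∑' k, α (k + 1)) := by
    have := Finset.sum_le_card_nsmul (Finset.range n)
      (fun i => ∫ ω, ∑ k ∈ Finset.range i, e k ω * Y i ω ∂ℙ) (8 * M ^ 2 * ∑' k, α (k + 1))
      fun i hi => by
        rw [integral_finsetSum _ (fun k _ => i1 i k)]
        calc _ ≤ ∑ k ∈ Finset.range i, 8 * M ^ 2 * α (i - k) :=
              Finset.sum_le_sum fun k hk => c1 i (Finset.mem_range.1 hi) k (Finset.mem_range.1 hk)
          _ = 8 * M ^ 2 * ∑ k ∈ Finset.range i, α (i - k) := by rw [Finset.mul_sum]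
          _ ≤ _ := mul_le_mul_of_nonneg_left (hs i) (by positivity)
    simpa using this
  rw [hsum.tsum_eq_zero_add]
  have : 0 ≤ n * (M ^ 2 * α 0) := by have := hα0 0; positivity
  nlinarith
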